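/- Let r ≥ 1 be an integer and let δ ∈ (0,1) be real. Then for all sufficiently large n the following holds: if f is a uniformly distributed random Boolean function on 𝔽₂ⁿ, then E[ 2ⁿ − 2·N_r(f) ] ≥ (1−δ)·√(2^{n+1}·C(n,r)·log 2). -/

import Mathlib

open MeasureTheory ProbabilityTheory Filter Real

noncomputable section

/-- Boolean functions on `𝔽₂ⁿ`. -/
abbrev BF (n : ℕ) := (Fin n → ZMod 2) → ZMod 2

/-- Hamming distance between Boolean functions. -/
def hdist {n : ℕ} (f g : BF n) : ℕ := Nat.card {x : Fin n → ZMod 2 | f x ≠ g x}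

/-- Weight of a Boolean function. -/
def wt {n : ℕ} (g : BF n) : ℕ := Nat.card {x : Fin n → ZMod 2 | g x ≠ 0}

/-- The Reed–Muller code `RM(r,n)`: Boolean functions of degree at most `r`. -/
def RM (r n : ℕ) : Set (BF n) :=
  {g | ∃ p : MvPolynomial (Fin n) (ZMod 2),
    p.totalDegree ≤ r ∧ ∀ x, MvPolynomial.eval x p = g x}

/-- The `r`-th order nonlinearity of a Boolean function. -/
def nonlin (r : ℕ) {n : ℕ} (f : BF n) : ℕ := sInf (hdist f '' RM r n)

/-- Extend `x ∈ 𝔽₂ⁿ` to a finitely supported sequence `(x₁,…,xₙ,0,0,…)`. -/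
def extend {n : ℕ} (x : Fin n → ZMod 2) : ℕ →₀ ZMod 2 :=
  ∑ i : Fin n, Finsupp.single (i : ℕ) (x i)


/-! ### Exponential moments and concentration on the cube -/

/-- The sign `(-1)^b`. -/
def sg (b : ZMod 2) : ℝ := if b = 0 then 1 else -1

/-- Average over all functions `V → 𝔽₂`. -/
def Em {V : Type} [Fintype V] [DecidableEq V] (F : (V → ZMod 2) → ℝ) : ℝ :=
  (∑ f, F f) / 2 ^ (Fintype.card V)

lemma zmod2_cases (b : ZMod 2) : b = 0 ∨ b = 1 := by
  revert b; decide

lemma sum_zmod2 (F : ZMod 2 → ℝ) : ∑ b, F b = F 0 + F 1 := Fin.sum_univ_two F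

lemma sg_zero : sg 0 = 1 := by simp [sg]
lemma sg_one : sg 1 = -1 := by simp [sg]
lemma sg_add (a b : ZMod 2) : sg (a + b) = sg a * sg b := by
  rcases zmod2_cases a with rfl | rfl <;> rcases zmod2_cases b with rfl | rfl
  · simp [sg_zero]
  · simp [sg_zero]
  · simp [sg_zero]
  · have : (1 : ZMod 2) + 1 = 0 := by decide
    rw [this]; simp [sg_zero, sg_one]
lemma sg_sq (a : ZMod 2) : sg a * sg a = 1 := by
  rcases zmod2_cases a with rfl | rfl <;> simp [sg_zero, sg_one]
lemma sg_le (a : ZMod 2) : sg a ≤ 1 := by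
  rcases zmod2_cases a with rfl | rfl <;> norm_num [sg_zero, sg_one]
lemma sg_ge (a : ZMod 2) : -1 ≤ sg a := by
  rcases zmod2_cases a with rfl | rfl <;> norm_num [sg_zero, sg_one]

section cube
variable {V : Type} [Fintype V] [DecidableEq V]

lemma Em_mono {F G : (V → ZMod 2) → ℝ} (h : ∀ f, F f ≤ G f) : Em F ≤ Em G := by
  unfold Em; gcongr; exact h _

lemma Em_add (F G : (V → ZMod 2) → ℝ) : Em (fun f => F f + G f) = Em F + Em G := by
  simp [Em, Finset.sum_add_distrib, add_div]

lemma Em_sub (F G : (V → ZMod 2) → ℝ) : Em (fun f => F f - G f) = Em F - Em G := by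
  simp [Em, Finset.sum_sub_distrib, sub_div]

lemma Em_mul (c : ℝ) (F : (V → ZMod 2) → ℝ) : Em (fun f => c * F f) = c * Em F := by
  simp [Em, ← Finset.mul_sum, mul_div_assoc]

lemma Em_const (c : ℝ) : Em (fun _ : V → ZMod 2 => c) = c := by
  simp [Em, ZMod.card]

lemma Em_sum {ι : Type*} (s : Finset ι) (F : ι → (V → ZMod 2) → ℝ) :
    Em (fun f => ∑ i ∈ s, F i f) = ∑ i ∈ s, Em (F i) := by
  simp only [Em, ← Finset.sum_div]
  rw [Finset.sum_comm]

lemma mgf0 (c : V → ℝ) :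
    Em (fun f => exp (∑ x, sg (f x) * c x)) = ∏ x, cosh (c x) := by
  unfold Em
  have h : ∀ f : V → ZMod 2, exp (∑ x, sg (f x) * c x) = ∏ x, exp (sg (f x) * c x) :=
    fun f => Real.exp_sum _ _
  simp only [h]
  rw [← Fintype.prod_sum (fun x b => exp (sg b * c x))]
  rw [show (2 : ℝ) ^ Fintype.card V = ∏ _x : V, (2 : ℝ) by simp, ← Finset.prod_div_distrib]
  refine Finset.prod_congr rfl fun x _ => ?_
  rw [sum_zmod2, sg_zero, sg_one, Real.cosh_eq]; simp

lemma conc_fin (k : ℕ) (c : ℝ) (F : (Fin k → ZMod 2) → ℝ)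
    (hF : ∀ f g i, (∀ j, j ≠ i → f j = g j) → F f - F g ≤ 2 * c) :
    (∑ f, exp (F f)) / 2 ^ k ≤ exp ((∑ f, F f) / 2 ^ k + c ^ 2 * k / 2) := by
  induction k with
  | zero => simp
  | succ k ih =>
    have split : ∀ G : (Fin (k+1) → ZMod 2) → ℝ, ∑ f, G f =
        (∑ f : Fin k → ZMod 2, G (Fin.cons 0 f)) + ∑ f : Fin k → ZMod 2, G (Fin.cons 1 f) := by
      intro G
      rw [← (Fin.consEquiv (fun _ => ZMod 2)).sum_comp, Fintype.sum_prod_type, sum_zmod2]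
      rfl
    have hs : ∀ b : ZMod 2, (∑ f : Fin k → ZMod 2, exp (F (Fin.cons b f))) / 2 ^ k ≤
        exp ((∑ f : Fin k → ZMod 2, F (Fin.cons b f)) / 2 ^ k + c ^ 2 * k / 2) := by
      intro b
      apply ih (fun f => F (Fin.cons b f))
      intro f g i h
      apply hF _ _ i.succ
      intro j
      refine Fin.cases ?_ ?_ j
      · simp
      · intro j hj
        simp only [Fin.cons_succ]
        exact h j (fun e => hj (by rw [e]))
    have hd : ∀ a b : ZMod 2, (∑ f : Fin k → ZMod 2, F (Fin.cons a f)) / 2 ^ k -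
        (∑ f : Fin k → ZMod 2, F (Fin.cons b f)) / 2 ^ k ≤ 2 * c := by
      intro a b
      rw [← sub_div, ← Finset.sum_sub_distrib, div_le_iff₀ (by positivity)]
      calc _ ≤ ∑ f : Fin k → ZMod 2, 2 * c := by
            refine Finset.sum_le_sum fun f _ => hF _ _ 0 ?_
            intro j
            refine Fin.cases ?_ ?_ j
            · simp
            · simp
        _ = _ := by simp [ZMod.card]; ring
    rw [split, split]
    have h0 := hs 0
    have h1 := hs 1
    have d01 := hd 0 1
    have d10 := hd 1 0
    generalize (∑ f : Fin k → ZMod 2, exp (F (Fin.cons 0 f))) = A0 at *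
    generalize (∑ f : Fin k → ZMod 2, exp (F (Fin.cons 1 f))) = A1 at *
    generalize hm0 : (∑ f : Fin k → ZMod 2, F (Fin.cons 0 f)) / 2 ^ k = m0 at *
    generalize hm1 : (∑ f : Fin k → ZMod 2, F (Fin.cons 1 f)) / 2 ^ k = m1 at *
    have e1 : (A0 + A1) / 2 ^ (k+1) = (A0 / 2^k + A1 / 2^k) / 2 := by rw [pow_succ]; field_simp
    have e2 : ((∑ f : Fin k → ZMod 2, F (Fin.cons 0 f)) +
      (∑ f : Fin k → ZMod 2, F (Fin.cons 1 f))) / 2 ^ (k+1) = (m0 + m1) / 2 := by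
      rw [← hm0, ← hm1, pow_succ]; field_simp
    rw [e1, e2]
    have hc := Real.cosh_le_exp_half_sq ((m0 - m1) / 2)
    have hsq : ((m0 - m1) / 2) ^ 2 ≤ c ^ 2 := by
      apply sq_le_sq.mpr
      have : |(m0 - m1) / 2| ≤ c := by rw [abs_le]; constructor <;> linarith
      exact this.trans (le_abs_self c)
    calc (A0 / 2^k + A1 / 2^k) / 2
        ≤ (exp (m0 + c ^ 2 * k / 2) + exp (m1 + c ^ 2 * k / 2)) / 2 := by linarith
      _ = exp ((m0 + m1) / 2 + c ^ 2 * k / 2) * cosh ((m0 - m1) / 2) := by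
        rw [Real.cosh_eq, ← mul_div_assoc, mul_add, ← Real.exp_add, ← Real.exp_add]
        congr 3 <;> ring
      _ ≤ exp ((m0 + m1) / 2 + c ^ 2 * k / 2) * exp (c ^ 2 / 2) := by
        gcongr
        exact hc.trans (Real.exp_le_exp.mpr (by linarith))
      _ = _ := by
        rw [← Real.exp_add]; push_cast; congr 1; ring

lemma conc (c : ℝ) (F : (V → ZMod 2) → ℝ)
    (hF : ∀ f g i, (∀ j, j ≠ i → f j = g j) → F f - F g ≤ 2 * c) :
    Em (fun f => exp (F f)) ≤ exp (Em F + c ^ 2 * Fintype.card V / 2) := by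
  let e := Fintype.equivFin V
  let E : (V → ZMod 2) ≃ (Fin (Fintype.card V) → ZMod 2) := e.arrowCongr (Equiv.refl _)
  have := conc_fin (Fintype.card V) c (fun f => F (E.symm f)) (by
    intro f g i h
    apply hF _ _ (e.symm i)
    intro j hj
    have : e j ≠ i := fun h' => hj (by rw [← h']; simp)
    simpa [E] using h (e j) this)
  rw [E.symm.sum_comp (fun f => exp (F f)), E.symm.sum_comp F] at this
  exact this

/-- Correlation sum. -/
def SS (g f : V → ZMod 2) : ℝ := ∑ x, sg (f x) * sg (g x)

lemma mgf1 (u : ℝ) (g : V → ZMod 2) :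
    Em (fun f => exp (u * SS g f)) = cosh u ^ Fintype.card V := by
  have : ∀ f, u * SS g f = ∑ x, sg (f x) * (u * sg (g x)) := by
    intro f; unfold SS; rw [Finset.mul_sum]; refine Finset.sum_congr rfl fun x _ => by ring
  simp only [this]
  rw [mgf0]
  rw [Finset.prod_congr rfl (g := fun _ => cosh u)]
  · simp
  · intro x _
    rcases zmod2_cases (g x) with h | h <;> simp [h, sg_zero, sg_one]

lemma mgf2 (a b : ℝ) (g h : V → ZMod 2) :
    Em (fun f => exp (a * SS g f + b * SS h f)) ≤
      exp (Fintype.card V * (a ^ 2 + b ^ 2) / 2 + a * b * SS g h) := by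
  have : ∀ f, a * SS g f + b * SS h f = ∑ x, sg (f x) * (a * sg (g x) + b * sg (h x)) := by
    intro f; unfold SS; rw [Finset.mul_sum, Finset.mul_sum, ← Finset.sum_add_distrib]
    refine Finset.sum_congr rfl fun x _ => by ring
  simp only [this]
  rw [mgf0]
  calc ∏ x, cosh (a * sg (g x) + b * sg (h x))
      ≤ ∏ x, exp ((a * sg (g x) + b * sg (h x)) ^ 2 / 2) := by
        refine Finset.prod_le_prod (fun x _ => (Real.cosh_pos _).le) fun x _ =>
          Real.cosh_le_exp_half_sq _
    _ = _ := by
      rw [← Real.exp_sum]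
      congr 1
      have : ∀ x, (a * sg (g x) + b * sg (h x)) ^ 2 / 2 =
          (a ^ 2 + b ^ 2) / 2 + a * b * (sg (h x) * sg (g x)) := by
        intro x
        linear_combination a^2/2 * sg_sq (g x) + b^2/2 * sg_sq (h x)
      simp only [this]
      rw [Finset.sum_add_distrib, SS, Finset.mul_sum]
      simp; ring

lemma SS_le (g h : V → ZMod 2) : SS g h ≤ Fintype.card V := by
  unfold SS
  calc _ ≤ ∑ x : V, (1 : ℝ) := by
        refine Finset.sum_le_sum fun x _ => ?_
        rw [← sg_add]; exact sg_le _
    _ = _ := by simp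

lemma SS_lip (g f f' : V → ZMod 2) (i : V) (h : ∀ j, j ≠ i → f j = f' j) :
    SS g f - SS g f' ≤ 2 := by
  unfold SS
  rw [← Finset.sum_sub_distrib, Finset.sum_eq_single i]
  · rw [← sg_add, ← sg_add]
    have := sg_le (f i + g i)
    have := sg_ge (f' i + g i)
    linarith
  · intro j _ hj
    rw [h j hj]; ring
  · simp

/-- Partition function. -/
def WW (C : Finset (V → ZMod 2)) (u : ℝ) (f : V → ZMod 2) : ℝ := ∑ g ∈ C, exp (u * SS g f)

lemma WW_pos {C : Finset (V → ZMod 2)} (hC : C.Nonempty) (u : ℝ) (f : V → ZMod 2) :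
    0 < WW C u f := Finset.sum_pos (fun _ _ => Real.exp_pos _) hC

lemma Em_WW (C : Finset (V → ZMod 2)) (u : ℝ) :
    Em (WW C u) = C.card * cosh u ^ Fintype.card V := by
  unfold WW
  rw [Em_sum]
  simp [mgf1]

lemma Em_log_le {F : (V → ZMod 2) → ℝ} (hF : ∀ f, 0 < F f) {Y : ℝ} (hY : 0 < Y)
    (h : Em F ≤ Y) : Em (fun f => log (F f)) ≤ log Y := by
  have : ∀ f, log (F f) ≤ Y⁻¹ * F f + (log Y - 1) := by
    intro f
    have := Real.log_le_sub_one_of_pos (x := F f / Y) (div_pos (hF f) hY)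
    rw [Real.log_div (hF f).ne' hY.ne'] at this
    rw [div_eq_inv_mul] at this
    linarith
  have h2 := Em_mono this
  rw [Em_add, Em_mul, Em_const] at h2
  have : Y⁻¹ * Em F ≤ 1 := by
    rw [inv_mul_le_iff₀ hY]; linarith
  linarith

lemma WW_conc {C : Finset (V → ZMod 2)} (hC : C.Nonempty) {u p : ℝ} (hu : 0 < u) (hp : 0 < p) :
    Em (fun f => exp (p * log (WW C u f))) ≤
      exp (p * Em (fun f => log (WW C u f)) + p ^ 2 * (u ^ 2 * Fintype.card V / 2)) := by
  have := conc (V := V) (p * u) (fun f => p * log (WW C u f)) (by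
    intro f g i h
    have : WW C u f ≤ exp (2 * u) * WW C u g := by
      unfold WW
      rw [Finset.mul_sum]
      refine Finset.sum_le_sum fun k _ => ?_
      rw [← Real.exp_add]
      apply Real.exp_le_exp.mpr
      nlinarith [SS_lip k f g i h]
    have h2 := Real.log_le_log (WW_pos hC u f) this
    rw [Real.log_mul (Real.exp_pos _).ne' (WW_pos hC u g).ne', Real.log_exp] at h2
    nlinarith)
  rw [Em_mul] at this
  convert this using 2
  ring

end cube

section core
variable {V : Type} [Fintype V] [DecidableEq V]

lemma trunc_pt (C : Finset (V → ZMod 2)) (hC : C.Nonempty) (u a b α p θ : ℝ) (hα : 0 < α)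
    (hp1 : p < 1)
    (hB : ∀ g ∈ C, ((C.filter (fun h => θ < SS g h)).card : ℝ) ≤ exp b) (f : V → ZMod 2) :
    WW C u f ≤ exp ((1 - p) * a) * exp (p * log (WW C u f)) +
      ∑ g ∈ C, (∑ h ∈ C.filter (fun h => θ < SS g h), exp (α * (log 2 + b - a)) *
          exp (u * SS g f + (α * u) * SS h f) +
        ∑ h ∈ C.filter (fun h => ¬ θ < SS g h), (2 * exp (-a)) *
          exp (u * SS g f + u * SS h f)) := by
  have hW := WW_pos hC u f
  by_cases hc : WW C u f ≤ exp a
  · have h1 : WW C u f ≤ exp ((1 - p) * a) * exp (p * log (WW C u f)) := by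
      rw [← Real.exp_add]
      nth_rw 1 [← Real.exp_log hW]
      apply Real.exp_le_exp.mpr
      have : log (WW C u f) ≤ a := by
        rw [Real.log_le_iff_le_exp hW]; exact hc
      nlinarith
    have h2 : 0 ≤ ∑ g ∈ C, (∑ h ∈ C.filter (fun h => θ < SS g h), exp (α * (log 2 + b - a)) *
          exp (u * SS g f + (α * u) * SS h f) +
        ∑ h ∈ C.filter (fun h => ¬ θ < SS g h), (2 * exp (-a)) *
          exp (u * SS g f + u * SS h f)) := by positivity
    linarith
  · push Not at hc
    have h1 : 0 ≤ exp ((1 - p) * a) * exp (p * log (WW C u f)) := by positivity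
    refine le_trans ?_ (le_add_of_nonneg_left h1)
    conv_lhs => unfold WW
    refine Finset.sum_le_sum fun g hg => ?_
    simp only [Real.exp_add (u * SS g f)]
    have key : 1 ≤ (∑ h ∈ C.filter (fun h => θ < SS g h), exp (α * (log 2 + b - a)) *
          exp ((α * u) * SS h f)) + 
        ∑ h ∈ C.filter (fun h => ¬ θ < SS g h), (2 * exp (-a)) * exp (u * SS h f) := by
      have hsplit := Finset.sum_filter_add_sum_filter_not C (fun h => θ < SS g h)
        (fun h => exp (u * SS h f))
      have hn1 : 0 ≤ ∑ h ∈ C.filter (fun h => θ < SS g h), exp (α * (log 2 + b - a)) *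
          exp ((α * u) * SS h f) := by positivity
      have hn2 : 0 ≤ ∑ h ∈ C.filter (fun h => ¬ θ < SS g h), (2 * exp (-a)) *
          exp (u * SS h f) := by positivity
      by_cases hgd : exp a / 2 ≤ ∑ h ∈ C.filter (fun h => ¬ θ < SS g h), exp (u * SS h f)
      · have : 1 ≤ ∑ h ∈ C.filter (fun h => ¬ θ < SS g h), (2 * exp (-a)) *
          exp (u * SS h f) := by
          rw [← Finset.mul_sum]
          calc (1 : ℝ) = (2 * exp (-a)) * (exp a / 2) := by
                rw [Real.exp_neg]; field_simp
            _ ≤ _ := by gcongr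
        linarith
      · push Not at hgd
        have hbad : exp a / 2 < ∑ h ∈ C.filter (fun h => θ < SS g h), exp (u * SS h f) := by
          have : WW C u f = ∑ h ∈ C, exp (u * SS h f) := rfl
          simp only [not_lt] at hgd hsplit
          linarith
        obtain ⟨h, hh, hge⟩ : ∃ h ∈ C.filter (fun h => θ < SS g h),
            exp a / (2 * exp b) ≤ exp (u * SS h f) := by
          by_contra! hcon
          have h3 := Finset.sum_le_card_nsmul _ (fun h => exp (u * SS h f)) _
            (fun h hh => (hcon h hh).le)
          rw [nsmul_eq_mul] at h3
          have h4 : ((C.filter (fun h => θ < SS g h)).card : ℝ) * (exp a / (2 * exp b)) ≤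
              exp b * (exp a / (2 * exp b)) := by
            gcongr; exact hB g hg
          have h5 : exp b * (exp a / (2 * exp b)) = exp a / 2 := by field_simp
          linarith
        have h6 : a - log 2 - b ≤ u * SS h f := by
          rw [← Real.exp_le_exp]
          refine le_trans (le_of_eq ?_) hge
          rw [Real.exp_sub, Real.exp_sub, Real.exp_log (by norm_num)]
          field_simp
        have h7 : 1 ≤ exp (α * (log 2 + b - a)) * exp ((α * u) * SS h f) := by
          rw [← Real.exp_add]
          apply Real.one_le_exp
          nlinarith
        have h8 := Finset.single_le_sum (s := C.filter (fun h => θ < SS g h))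
          (f := fun h => exp (α * (log 2 + b - a)) * exp ((α * u) * SS h f))
          (fun i _ => by positivity) hh
        linarith
    calc exp (u * SS g f) = exp (u * SS g f) * 1 := by ring
      _ ≤ exp (u * SS g f) * _ := mul_le_mul_of_nonneg_left key (Real.exp_pos _).le
      _ = _ := by
        rw [mul_add, Finset.mul_sum, Finset.mul_sum]
        congr 1 <;> refine Finset.sum_congr rfl fun h _ => by ring

lemma trunc (C : Finset (V → ZMod 2)) (hC : C.Nonempty) (u a b α p ε : ℝ) (hα : 0 < α)
    (hp1 : p < 1) (hu : 0 < u)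
    (hB : ∀ g ∈ C, ((C.filter (fun h => ε * Fintype.card V < SS g h)).card : ℝ) ≤ exp b)
    (Q : ℝ) (hQ : Q = u ^ 2 * Fintype.card V / 2) :
    Em (WW C u) ≤ exp ((1 - p) * a) * Em (fun f => exp (p * log (WW C u f))) +
      C.card * (exp b * (exp (α * (log 2 + b - a)) * exp ((1 + α) ^ 2 * Q)) +
        C.card * ((2 * exp (-a)) * exp (2 * Q * (1 + ε)))) := by
  refine (Em_mono (trunc_pt C hC u a b α p _ hα hp1 hB)).trans ?_
  rw [Em_add, Em_mul, Em_sum]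
  gcongr
  rw [← nsmul_eq_mul]
  refine Finset.sum_le_card_nsmul _ _ _ fun g hg => ?_
  rw [Em_add, Em_sum, Em_sum]
  gcongr
  · refine le_trans (Finset.sum_le_card_nsmul _ _
      (exp (α * (log 2 + b - a)) * exp ((1 + α) ^ 2 * Q)) fun h hh => ?_) ?_
    · rw [Em_mul]
      gcongr
      refine (mgf2 _ _ _ _).trans (Real.exp_le_exp.mpr ?_)
      have := SS_le g h
      have h2 : u * (α * u) * SS g h ≤ u * (α * u) * Fintype.card V := by gcongr
      rw [hQ]; linarith
    · rw [nsmul_eq_mul]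
      gcongr
      exact hB g hg
  · refine le_trans (Finset.sum_le_card_nsmul _ _
      ((2 * exp (-a)) * exp (2 * Q * (1 + ε))) fun h hh => ?_) ?_
    · rw [Em_mul]
      gcongr
      refine (mgf2 _ _ _ _).trans (Real.exp_le_exp.mpr ?_)
      have := not_lt.mp (Finset.mem_filter.mp hh).2
      have h2 : u * u * SS g h ≤ u * u * (ε * Fintype.card V) := by gcongr
      rw [hQ]; linarith
    · rw [nsmul_eq_mul]
      gcongr
      exact Finset.filter_subset _ _

lemma cosh_lower (u : ℝ) (hu : 0 ≤ u) : exp (u ^ 2 / 2 * (1 - u ^ 2 / 4)) ≤ cosh u := by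
  have h1 : 1 + u ^ 2 / 2 ≤ cosh u := by
    have h2 : u / 2 ≤ sinh (u / 2) := Real.self_le_sinh_iff.mpr (by positivity)
    have h3 := Real.cosh_two_mul (u / 2)
    have h4 := Real.cosh_sq (u / 2)
    rw [show 2 * (u / 2) = u by ring] at h3
    nlinarith
  refine le_trans ?_ h1
  have hx : 0 ≤ u ^ 2 / 2 := by positivity
  rw [← Real.le_log_iff_exp_le (by positivity)]
  refine le_trans ?_ (Real.le_log_one_add_of_nonneg hx)
  generalize u ^ 2 = y at *
  rw [le_div_iff₀ (by positivity)]
  nlinarith [mul_nonneg hx (mul_nonneg hx hx)]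

/-- Lower bound for the expected free energy. -/
lemma phi_lower (C : Finset (V → ZMod 2)) (hC : C.Nonempty) (u b η p ε κ Λ Q : ℝ)
    (hη : 0 < η) (hp : 0 < p) (hp1 : p < 1) (hu : 0 < u) (hε : 0 < ε) (hη1 : η < 1)
    (hB : ∀ g ∈ C, ((C.filter (fun h => ε * Fintype.card V < SS g h)).card : ℝ) ≤ exp b)
    (hΛ : Λ = log C.card) (hQ : Q = u ^ 2 * Fintype.card V / 2)
    (hQΛ : Q = (1 - η) * Λ) (hκ : u ^ 2 / 4 ≤ κ) (hb0 : 0 ≤ b)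
    (hcond : 2 * b + κ * Λ + log 4 ≤ η ^ 3 * Λ) :
    p * (Λ + Q) - p ^ 2 * Q - (2 * κ * Q + 2 * ε * Q + log 16) ≤
      p * Em (fun f => log (WW C u f)) := by
  have hK : (0 : ℝ) < C.card := by exact_mod_cast hC.card_pos
  have hKe : (C.card : ℝ) = exp Λ := by rw [hΛ, Real.exp_log hK]
  have hκ0 : 0 ≤ κ := le_trans (by positivity) hκ
  have hQ0 : 0 ≤ Q := by rw [hQ]; positivity
  have hΛ0 : 0 ≤ Λ := by
    by_contra hneg
    push Not at hneg
    nlinarith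
  have l4 : log 4 = 2 * log 2 := by
    rw [show (4 : ℝ) = 2 ^ 2 by norm_num, Real.log_pow]; norm_num
  have l8 : log 8 = 3 * log 2 := by
    rw [show (8 : ℝ) = 2 ^ 3 by norm_num, Real.log_pow]; norm_num
  have l16 : log 16 = 4 * log 2 := by
    rw [show (16 : ℝ) = 2 ^ 4 by norm_num, Real.log_pow]; norm_num
  have l2 : 0 < log 2 := Real.log_pos (by norm_num)
  set a := Λ + Q * (1 + 2 * ε + κ) + log 8 with ha
  have ht := trunc C hC u a b η p ε hη hp1 hu hB Q hQ
  have hlow : exp (Λ + Q * (1 - κ)) ≤ Em (WW C u) := by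
    rw [Em_WW, hKe, Real.exp_add]
    gcongr
    calc exp (Q * (1 - κ)) ≤ exp (u ^ 2 / 2 * (1 - u ^ 2 / 4)) ^ Fintype.card V := by
          rw [← Real.exp_nat_mul]
          apply Real.exp_le_exp.mpr
          have : (Fintype.card V : ℝ) * (u ^ 2 / 2 * (1 - u ^ 2 / 4)) = Q * (1 - u^2/4) := by
            rw [hQ]; ring
          rw [this]; gcongr
      _ ≤ _ := by gcongr; exact cosh_lower u hu.le
  have e14 : exp (Λ + Q * (1 - κ)) / 4 = exp (Λ + Q * (1 - κ) - log 4) := by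
    rw [Real.exp_sub, Real.exp_log (by norm_num)]
  have t1 : C.card * (exp b * (exp (η * (log 2 + b - a)) * exp ((1 + η) ^ 2 * Q))) ≤
      exp (Λ + Q * (1 - κ)) / 4 := by
    rw [e14, hKe, ← Real.exp_add, ← Real.exp_add, ← Real.exp_add]
    apply Real.exp_le_exp.mpr
    have h1 : Λ + Q + log 8 ≤ a := by rw [ha]; nlinarith [mul_nonneg hQ0 hε.le, mul_nonneg hQ0 hκ0]
    have h2 : η * (log 2 + b - a) ≤ η * (log 2 + b - (Λ + Q + log 8)) := by gcongr
    have h3 : η * b ≤ b := by nlinarith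
    have h4 : η * (log 2 - log 8) ≤ 0 := by rw [l8]; nlinarith
    have h5 : κ * Q ≤ κ * Λ := by
      apply mul_le_mul_of_nonneg_left _ hκ0
      rw [hQΛ]; nlinarith
    have h6 : η * (1 + η) * Q = η * Λ - η ^ 3 * Λ := by rw [hQΛ]; ring
    nlinarith
  have t2 : C.card * (C.card * ((2 * exp (-a)) * exp (2 * Q * (1 + ε)))) ≤
      exp (Λ + Q * (1 - κ)) / 4 := by
    rw [e14, hKe]
    rw [show 2 * exp (-a) = exp (log 2) * exp (-a) by rw [Real.exp_log (by norm_num)]]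
    simp only [← Real.exp_add]
    apply Real.exp_le_exp.mpr
    rw [ha, l8, l4]
    apply le_of_eq; ring
  have ht2 : exp (Λ + Q * (1 - κ)) / 2 ≤
      exp ((1 - p) * a) * Em (fun f => exp (p * log (WW C u f))) := by
    rw [mul_add (C.card : ℝ)] at ht
    linarith
  have hcc := WW_conc hC hu hp
  rw [← hQ] at hcc
  have h9 : exp (Λ + Q * (1 - κ)) / 2 ≤ exp ((1 - p) * a) *
      exp (p * Em (fun f => log (WW C u f)) + p ^ 2 * Q) :=
    ht2.trans (by gcongr)
  have e12 : exp (Λ + Q * (1 - κ)) / 2 = exp (Λ + Q * (1 - κ) - log 2) := by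
    rw [Real.exp_sub, Real.exp_log (by norm_num)]
  rw [e12, ← Real.exp_add, Real.exp_le_exp] at h9
  have h10 : (1 - p) * a ≤ (1 - p) * (Λ + Q) + (2 * ε * Q + κ * Q + log 8) := by
    have : 0 ≤ 2 * ε * Q + κ * Q + log 8 := by rw [l8]; positivity
    have h11 := mul_nonneg hp.le this
    rw [ha]; linarith
  rw [l16]; rw [l8] at h10
  linarith

set_option maxHeartbeats 1000000 in
/-- Main probabilistic bound. -/
theorem core (C : Finset (V → ZMod 2)) (hC : C.Nonempty) (M : (V → ZMod 2) → ℝ)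
    (hM : ∀ f, ∀ g ∈ C, SS g f ≤ M f) (b η Λ : ℝ) (hN : (0 : ℝ) < Fintype.card V)
    (hη : 0 < η) (hη1 : η < 1 / 4) (hΛ : Λ = log C.card) (hΛ0 : 0 < Λ)
    (hB : ∀ g ∈ C, ((C.filter (fun h => η ^ 4 / 8 * Fintype.card V < SS g h)).card : ℝ) ≤ exp b)
    (hb0 : 0 ≤ b) (hb : 2 * b ≤ η ^ 3 / 3 * Λ)
    (hΛN : Λ ≤ η ^ 4 / 16 * Fintype.card V) (hΛbig : log 16 ≤ η ^ 4 / 16 * Λ) :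
    (1 - 4 * η) * sqrt (2 * Fintype.card V * Λ) ≤ Em M := by
  set N : ℝ := (Fintype.card V : ℝ) with hNdef
  have hN' : 0 < N := hN
  set Q := (1 - η) * Λ with hQdef
  have hQ0 : 0 < Q := mul_pos (by linarith) hΛ0
  set u := sqrt (2 * Q / N) with hu
  have hu0 : 0 < u := Real.sqrt_pos.mpr (by positivity)
  have hu2 : u ^ 2 = 2 * Q / N := Real.sq_sqrt (by positivity)
  have hQ : Q = u ^ 2 * N / 2 := by rw [hu2]; field_simp
  have hQΛ : Q ≤ Λ := by rw [hQdef]; nlinarith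
  have hκ : u ^ 2 / 4 ≤ η ^ 4 / 16 := by
    rw [hu2]
    have : 2 * Q / N ≤ η ^ 4 / 4 := by
      rw [div_le_iff₀ hN']
      nlinarith
    linarith
  have h43 : η ^ 4 ≤ η ^ 3 / 4 := by
    have : 0 < η ^ 3 := by positivity
    nlinarith
  have hη3 : η ^ 4 * Λ ≤ η ^ 3 / 4 * Λ := by gcongr
  have hl416 : log 4 ≤ log 16 := Real.log_le_log (by norm_num) (by norm_num)
  have hpl := phi_lower C hC u b η (η ^ 2) (η ^ 4 / 8) (η ^ 4 / 16) Λ Q hη (by positivity)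
    (by nlinarith) hu0 (by positivity) (by linarith) hB hΛ hQ rfl hκ hb0
    (by have : 0 < η ^ 3 * Λ := by positivity
        nlinarith)
  -- upper bound at the smaller parameter
  have hK : (0 : ℝ) < C.card := by exact_mod_cast hC.card_pos
  have hup : Em (fun f => log (WW C ((1 - η) * u) f)) ≤ Λ + (1 - η) ^ 2 * Q := by
    have := Em_log_le (V := V) (F := WW C ((1 - η) * u)) (fun f => WW_pos hC _ f)
      (Y := exp (Λ + (1 - η) ^ 2 * Q)) (Real.exp_pos _) (by
        rw [Em_WW, Real.exp_add, show exp Λ = C.card by rw [hΛ, Real.exp_log hK]]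
        refine mul_le_mul_of_nonneg_left ?_ hK.le
        calc cosh ((1 - η) * u) ^ Fintype.card V ≤
            exp (((1 - η) * u) ^ 2 / 2) ^ Fintype.card V := by
              gcongr
              exact Real.cosh_le_exp_half_sq _
          _ = _ := by
            rw [← Real.exp_nat_mul, hQ]; congr 1; ring)
    rwa [Real.log_exp] at this
  have hdiff : Em (fun f => log (WW C u f)) - Em (fun f => log (WW C ((1 - η) * u) f)) ≤
      (η * u) * Em M := by
    rw [← Em_sub, ← Em_mul]
    refine Em_mono fun f => ?_
    have : WW C u f ≤ exp ((η * u) * M f) * WW C ((1 - η) * u) f := by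
      unfold WW
      rw [Finset.mul_sum]
      refine Finset.sum_le_sum fun g hg => ?_
      rw [← Real.exp_add]
      apply Real.exp_le_exp.mpr
      have h1 : (η * u) * SS g f ≤ (η * u) * M f := by gcongr; exact hM f g hg
      linarith
    have h2 := Real.log_le_log (WW_pos hC u f) this
    rw [Real.log_mul (Real.exp_pos _).ne' (WW_pos hC _ f).ne', Real.log_exp] at h2
    linarith
  -- combine
  have hQl : log 16 ≤ η ^ 4 / 8 * Q := by
    have : η ^ 4 / 16 * Λ ≤ η ^ 4 / 8 * Q := by
      rw [hQdef]
      have : 0 < η ^ 4 * Λ := by positivity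
      nlinarith
    linarith
  have h1 : η ^ 2 * (Λ + Q) - (η ^ 2) ^ 2 * Q - η ^ 4 * Q ≤
      η ^ 2 * Em (fun f => log (WW C u f)) := by
    have : 0 < η ^ 4 * Q := by positivity
    nlinarith
  have h2 : Λ + Q - 2 * η ^ 2 * Q ≤ Em (fun f => log (WW C u f)) := by
    have hη2 : 0 < η ^ 2 := by positivity
    apply le_of_mul_le_mul_left _ hη2
    linarith
  have h3 : η * (2 * Q * (1 - 3 / 2 * η)) ≤ η * (u * Em M) := by nlinarith
  have h4 : 2 * Q * (1 - 3 / 2 * η) ≤ u * Em M := le_of_mul_le_mul_left h3 hη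
  have h5 : u * N * (1 - 3 / 2 * η) ≤ Em M := by
    apply le_of_mul_le_mul_left _ hu0
    refine le_trans (le_of_eq ?_) h4
    rw [hQ]; ring
  have h6 : (1 - η) * sqrt (2 * N * Λ) ≤ u * N := by
    apply le_of_sq_le_sq _ (by positivity)
    rw [mul_pow, Real.sq_sqrt (by positivity), mul_pow, hu2, hQdef]
    have : 2 * ((1 - η) * Λ) / N * N ^ 2 = (1 - η) * (2 * N * Λ) := by field_simp
    rw [this]
    have : 0 < 2 * N * Λ := by positivity
    apply mul_le_mul_of_nonneg_right _ this.le
    clear * - hη hη1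
    nlinarith
  calc (1 - 4 * η) * sqrt (2 * N * Λ) ≤ ((1 - η) * (1 - 3 / 2 * η)) * sqrt (2 * N * Λ) := by
        gcongr; nlinarith
    _ = ((1 - η) * sqrt (2 * N * Λ)) * (1 - 3 / 2 * η) := by ring
    _ ≤ u * N * (1 - 3 / 2 * η) := by
        gcongr; linarith
    _ ≤ _ := h5

end core

/-! ### Reed–Muller codes -/

section reedmuller
variable {n : ℕ}

lemma RM_zero (k : ℕ) : (0 : BF n) ∈ RM k n := ⟨0, by simp, by simp⟩

lemma RM_add {k : ℕ} {g h : BF n} (hg : g ∈ RM k n) (hh : h ∈ RM k n) : g + h ∈ RM k n := by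
  obtain ⟨p, hp, hp'⟩ := hg
  obtain ⟨q, hq, hq'⟩ := hh
  exact ⟨p + q, (MvPolynomial.totalDegree_add _ _).trans (max_le hp hq), by simp [hp', hq']⟩

lemma RM_const (k : ℕ) (c : ZMod 2) : (fun _ => c : BF n) ∈ RM k n :=
  ⟨MvPolynomial.C c, by simp, by simp⟩

lemma RM_mono {k l : ℕ} (h : k ≤ l) {g : BF n} (hg : g ∈ RM k n) : g ∈ RM l n := by
  obtain ⟨p, hp, hp'⟩ := hg
  exact ⟨p, hp.trans h, hp'⟩

lemma RM_smul {k : ℕ} (c : ZMod 2) {g : BF n} (hg : g ∈ RM k n) :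
    (fun x => c * g x) ∈ RM k n := by
  rcases zmod2_cases c with rfl | rfl
  · simpa using RM_const k 0
  · simpa using hg

lemma RM_X_mul {k : ℕ} (i : Fin n) {g : BF n} (hg : g ∈ RM k n) :
    (fun x => x i * g x) ∈ RM (k + 1) n := by
  obtain ⟨p, hp, hp'⟩ := hg
  refine ⟨MvPolynomial.X i * p, (MvPolynomial.totalDegree_mul _ _).trans ?_, by simp [hp']⟩
  rw [MvPolynomial.totalDegree_X]; omega

lemma RM_mono_mem (s : Multiset (Fin n)) : ∀ k, Multiset.card s ≤ k →
    (fun x => (s.map x).prod : BF n) ∈ RM k n := by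
  induction s using Multiset.induction_on with
  | empty => intro k _; simpa using RM_const k 1
  | cons i s ih =>
    intro k hk
    rw [Multiset.card_cons] at hk
    obtain ⟨k, rfl⟩ : ∃ l, k = l + 1 := ⟨k - 1, by omega⟩
    simpa using RM_X_mul i (ih k (by omega))

lemma RM_ind {k : ℕ} (P : BF n → Prop) (h0 : P 0) (hadd : ∀ g h, P g → P h → P (g + h))
    (hm : ∀ s : Multiset (Fin n), Multiset.card s ≤ k → P (fun x => (s.map x).prod))
    {g : BF n} (hg : g ∈ RM k n) : P g := by
  obtain ⟨p, hp, hp'⟩ := hg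
  have hge : g = ∑ d ∈ p.support, (fun x => ((Finsupp.toMultiset d).map x).prod : BF n) := by
    funext x
    rw [← hp' x, MvPolynomial.eval_eq, Finset.sum_apply]
    refine Finset.sum_congr rfl fun d hd => ?_
    have h1 : p.coeff d = 1 := by
      rcases zmod2_cases (p.coeff d) with h | h
      · exact absurd h (MvPolynomial.mem_support_iff.mp hd)
      · exact h
    rw [h1, one_mul, Finsupp.toMultiset_map, Finsupp.prod_toMultiset,
      Finsupp.prod_mapDomain_index (by simp) (by intros; rw [pow_add])]
    rfl
  rw [hge]
  refine Finset.sum_induction _ P hadd h0 fun d hd => hm _ ?_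
  rw [MvPolynomial.totalDegree_eq] at hp
  exact (Finset.le_sup (f := fun m => Multiset.card (Finsupp.toMultiset m)) hd).trans hp

lemma RM_deriv {k : ℕ} (a : Fin n → ZMod 2) {g : BF n} (hg : g ∈ RM (k + 1) n) :
    (fun x => g (x + a) + g x) ∈ RM k n := by
  refine RM_ind (fun g => (fun x => g (x + a) + g x) ∈ RM k n) ?_ ?_ ?_ hg
  · simpa using RM_const k 0
  · intro g h hg hh
    convert RM_add hg hh using 1
    funext x; simp only [Pi.add_apply]; ring
  · intro s
    clear hg
    revert k
    induction s using Multiset.induction_on with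
    | empty =>
      intro k _
      simp only [Multiset.map_zero, Multiset.prod_zero]
      exact RM_const k _
    | cons i s ih =>
      intro k hs
      rw [Multiset.card_cons] at hs
      simp only [Multiset.map_cons, Multiset.prod_cons]
      have hsk := RM_mono_mem s k (by omega)
      rcases k with _ | k
      · have : s = 0 := Multiset.card_eq_zero.mp (by omega)
        subst this
        convert RM_const 0 (a i) using 1
        funext x
        have : x i + x i = 0 := CharTwo.add_self_eq_zero _
        simp only [Pi.add_apply, Multiset.map_zero, Multiset.prod_zero]
        linear_combination this
      · have hd := ih (k := k) (by omega)
        have e := RM_add (RM_X_mul i hd) (RM_smul (a i) (RM_add (RM_mono (Nat.le_succ k) hd) hsk))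
        convert e using 1
        funext x
        simp only [Pi.add_apply]
        have h1 : ∀ z : ZMod 2, z + z = 0 := CharTwo.add_self_eq_zero
        generalize (s.map x).prod = A
        generalize (s.map (x + a)).prod = B
        linear_combination (-a i) * h1 A

lemma RM_zero_const {g : BF n} (hg : g ∈ RM 0 n) (x y) : g x = g y := by
  obtain ⟨p, hp, hp'⟩ := hg
  have := MvPolynomial.totalDegree_eq_zero_iff_eq_C.mp (Nat.le_zero.mp hp)
  rw [← hp', ← hp', this]; simp

lemma const_card (g : BF n) (hg : ∀ x y, g x = g y) (h0 : g ≠ 0) :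
    2 ^ n ≤ (Finset.univ.filter fun x => g x ≠ 0).card := by
  have : ∀ x, g x ≠ 0 := by
    intro x hx
    exact h0 (funext fun y => (hg y x).trans hx)
  rw [Finset.filter_true_of_mem (fun x _ => this x)]
  simp [ZMod.card]

lemma RM_min_dist (k : ℕ) : ∀ g : BF n, g ∈ RM k n → g ≠ 0 →
    2 ^ n ≤ 2 ^ k * (Finset.univ.filter fun x => g x ≠ 0).card := by
  induction k with
  | zero =>
    intro g hg h0
    simpa using const_card g (RM_zero_const hg) h0
  | succ k ih =>
    intro g hg h0
    by_cases hc : ∃ a : Fin n → ZMod 2, (fun x => g (x + a) + g x : BF n) ≠ 0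
    · obtain ⟨a, ha⟩ := hc
      have h1 := ih _ (RM_deriv a hg) ha
      have h2 : (Finset.univ.filter fun x => g (x + a) + g x ≠ 0).card ≤
          2 * (Finset.univ.filter fun x => g x ≠ 0).card := by
        calc _ ≤ ((Finset.univ.filter fun x => g (x + a) ≠ 0) ∪
              (Finset.univ.filter fun x => g x ≠ 0)).card := by
              apply Finset.card_le_card
              intro x
              simp only [Finset.mem_filter, Finset.mem_univ, true_and, Finset.mem_union]
              intro h
              by_contra! hh
              rw [hh.1, hh.2] at h
              simp at h
          _ ≤ _ := Finset.card_union_le _ _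
          _ = _ := by
            have : (Finset.univ.filter fun x => g (x + a) ≠ 0).card =
                (Finset.univ.filter fun x => g x ≠ 0).card :=
              Finset.card_equiv (Equiv.addRight a) (by simp)
            omega
      calc 2 ^ n ≤ _ := h1
        _ ≤ 2 ^ k * (2 * _) := Nat.mul_le_mul_left _ h2
        _ = _ := by ring
    · push Not at hc
      have h1 := const_card g (fun x y => by
        have := congrFun (hc (x - y)) y
        simp only [Pi.zero_apply, add_sub_cancel] at this
        exact CharTwo.add_eq_zero.mp this) h0
      exact h1.trans (Nat.le_mul_of_pos_left _ (by positivity))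

/-- The code as a finset. -/
def RMf (k n : ℕ) : Finset (BF n) := by
  classical exact Finset.univ.filter (fun g => g ∈ RM k n)

lemma mem_RMf {k : ℕ} {g : BF n} : g ∈ RMf k n ↔ g ∈ RM k n := by simp [RMf]

lemma mono_tuple : ∀ (k : ℕ) (s : Multiset (Fin n)), Multiset.card s ≤ k →
    ∃ v : Fin k → Option (Fin n), ∀ x : Fin n → ZMod 2,
      (s.map x).prod = ∏ j, (v j).elim 1 x := by
  intro k
  induction k with
  | zero =>
    intro s hs
    have : s = 0 := Multiset.card_eq_zero.mp (by omega)
    subst this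
    exact ⟨fun _ => none, by simp⟩
  | succ k ih =>
    intro s hs
    induction s using Multiset.induction_on with
    | empty => exact ⟨fun _ => none, by simp⟩
    | cons i s _ =>
      rw [Multiset.card_cons] at hs
      obtain ⟨v, hv⟩ := ih s (by omega)
      refine ⟨Fin.cons (some i) v, fun x => ?_⟩
      rw [Fin.prod_univ_succ]
      simp [hv]

lemma RMf_card_le (k n : ℕ) : (RMf k n).card ≤ 2 ^ ((n + 1) ^ k) := by
  classical
  let Φ : ((Fin k → Option (Fin n)) → ZMod 2) → BF n :=
    fun c x => ∑ v, c v * ∏ j, (v j).elim 1 x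
  have : RMf k n ⊆ Finset.univ.image Φ := by
    intro g hg
    rw [mem_RMf] at hg
    simp only [Finset.mem_image, Finset.mem_univ, true_and]
    refine RM_ind (fun g => ∃ c, Φ c = g) ⟨0, by funext x; simp [Φ]⟩ ?_ ?_ hg
    · rintro _ _ ⟨c, rfl⟩ ⟨d, rfl⟩
      exact ⟨c + d, by funext x; simp [Φ, add_mul, Finset.sum_add_distrib]⟩
    · intro s hs
      obtain ⟨v, hv⟩ := mono_tuple k s hs
      exact ⟨Pi.single v 1, by funext x; simp [Φ, hv, Pi.single_apply]⟩
  calc _ ≤ _ := Finset.card_le_card this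
    _ ≤ _ := Finset.card_image_le
    _ = _ := by simp [ZMod.card]

lemma RMf_card_ge (k n : ℕ) : 2 ^ (n.choose k) ≤ (RMf k n).card := by
  classical
  let I := {S : Finset (Fin n) // S.card = k}
  let Φ : (I → ZMod 2) → BF n := fun c x => ∑ S : I, c S * ∏ i ∈ S.1, x i
  have hmem : ∀ c, Φ c ∈ RMf k n := by
    intro c
    rw [mem_RMf]
    have : Φ c = ∑ S : I, (fun x => c S * ∏ i ∈ S.1, x i) := by
      funext x; simp [Φ]
    rw [this]
    refine Finset.sum_induction _ (· ∈ RM k n) (fun _ _ => RM_add) (RM_zero k) fun S _ => ?_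
    refine RM_smul _ ?_
    exact RM_mono_mem S.1.val k S.2.le
  have hinj : Function.Injective Φ := by
    intro c d h
    funext T
    have key : ∀ c, Φ c (fun i => if i ∈ T.1 then 1 else 0) = c T := by
      intro c
      simp only [Φ]
      rw [Finset.sum_eq_single T]
      · rw [Finset.prod_congr rfl (g := fun _ => 1)]
        · simp
        · intro i hi; simp [hi]
      · intro S _ hST
        obtain ⟨i, hi, hiT⟩ : ∃ i ∈ S.1, i ∉ T.1 := by
          by_contra! hsub
          exact hST (Subtype.ext (Finset.eq_of_subset_of_card_le hsub (by rw [S.2, T.2])))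
        rw [Finset.prod_eq_zero hi (by simp [hiT])]; simp
      · simp
    rw [← key c, ← key d, h]
  calc 2 ^ (n.choose k) = Fintype.card (I → ZMod 2) := by
        simp [I, ZMod.card]
    _ = (Finset.univ.image Φ).card := by rw [Finset.card_image_of_injective _ hinj]; simp
    _ ≤ _ := Finset.card_le_card (by intro g hg; simp at hg; obtain ⟨c, rfl⟩ := hg; exact hmem c)

/-- Points where the majority of the shifts fails. -/
def Fail {t : ℕ} (h : BF n) (a : Fin t → Fin n → ZMod 2) : Finset (Fin n → ZMod 2) :=
  Finset.univ.filter fun x => ∑ j, sg (h (x + a j)) ≤ 0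

lemma exists_shift (h : BF n) (ε : ℝ) (hε : 0 < ε) (hε1 : ε < 1) (t : ℕ) (τ : ℝ)
    (ht : (1 - ε ^ 2 / 2) ^ t < τ) (hh : ε * 2 ^ n < ∑ x, sg (h x)) :
    ∃ a : Fin t → Fin n → ZMod 2, ((Fail h a).card : ℝ) < τ * 2 ^ n := by
  by_contra! hcon
  let y := 1 + ε
  have hy : 0 < y := by positivity
  let φ : ZMod 2 → ℝ := fun b => exp (-log y * sg b)
  have hφ : ∀ b, φ b = (y + y⁻¹) / 2 - (y - y⁻¹) / 2 * sg b := by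
    intro b
    rcases zmod2_cases b with rfl | rfl
    · simp only [φ, sg_zero, mul_one, Real.exp_neg, Real.exp_log hy]; ring
    · simp only [φ, sg_one, mul_neg, mul_one, neg_neg, Real.exp_log hy]; ring
  have hsum : ∑ v, φ (h v) ≤ 2 ^ n * (1 - ε ^ 2 / 2) := by
    simp only [hφ]
    rw [Finset.sum_sub_distrib, ← Finset.mul_sum]
    have hy1 : 0 < (y - y⁻¹) / 2 := by
      have : y⁻¹ < 1 := inv_lt_one_of_one_lt₀ (by simp [y, hε])
      have : 1 < y := by simp [y, hε]
      linarith
    have h1 := mul_lt_mul_of_pos_left hh hy1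
    have h2 : (y + y⁻¹) / 2 - (y - y⁻¹) / 2 * ε = 1 - ε ^ 2 / 2 := by
      simp only [y]; field_simp; ring
    simp only [Finset.sum_const, Finset.card_univ, Fintype.card_pi, ZMod.card, Finset.prod_const,
      Fintype.card_fin, nsmul_eq_mul, Nat.cast_pow, Nat.cast_ofNat]
    rw [← h2]
    linarith
  have hpos : 0 ≤ ∑ v, φ (h v) := Finset.sum_nonneg fun _ _ => (Real.exp_pos _).le
  have hx : ∀ x, ∑ a : Fin t → Fin n → ZMod 2, ∏ j, φ (h (x + a j)) = (∑ v, φ (h v)) ^ t := by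
    intro x
    rw [← Fintype.prod_sum (fun (_ : Fin t) v => φ (h (x + v)))]
    rw [Finset.prod_const, Finset.card_univ, Fintype.card_fin]
    rw [← Equiv.sum_comp (Equiv.addLeft x) (fun v => φ (h v))]
    rfl
  have hfail : ∀ a : Fin t → Fin n → ZMod 2,
      ((Fail h a).card : ℝ) ≤ ∑ x, ∏ j, φ (h (x + a j)) := by
    intro a
    have : ((Fail h a).card : ℝ) = ∑ x ∈ Fail h a, (1 : ℝ) := by simp
    rw [this]
    refine le_trans (Finset.sum_le_sum (g := fun x => ∏ j, φ (h (x + a j))) ?_)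
      (Finset.sum_le_univ_sum_of_nonneg fun x =>
        Finset.prod_nonneg fun _ _ => (Real.exp_pos _).le)
    intro x hx
    have hx' : ∑ j, sg (h (x + a j)) ≤ 0 := by simpa [Fail] using hx
    simp only [φ]
    rw [← Real.exp_sum, ← Finset.mul_sum]
    apply Real.one_le_exp
    have : 0 < log y := Real.log_pos (by simp [y, hε])
    nlinarith
  have hA : ∑ a : Fin t → Fin n → ZMod 2, τ * 2 ^ n ≤ 2 ^ n * (2 ^ n * (1 - ε ^ 2 / 2)) ^ t := by
    calc _ ≤ ∑ a : Fin t → Fin n → ZMod 2, ((Fail h a).card : ℝ) :=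
          Finset.sum_le_sum fun a _ => hcon a
      _ ≤ ∑ a : Fin t → Fin n → ZMod 2, ∑ x, ∏ j, φ (h (x + a j)) :=
          Finset.sum_le_sum fun a _ => hfail a
      _ = ∑ x : Fin n → ZMod 2, (∑ v, φ (h v)) ^ t := by
          rw [Finset.sum_comm]; exact Finset.sum_congr rfl fun x _ => hx x
      _ = 2 ^ n * (∑ v, φ (h v)) ^ t := by simp [ZMod.card]
      _ ≤ _ := by gcongr
  simp only [Finset.sum_const, Finset.card_univ, Fintype.card_pi, ZMod.card, Finset.prod_const,
      Fintype.card_fin, nsmul_eq_mul, Nat.cast_pow, Nat.cast_ofNat] at hA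
  rw [mul_pow] at hA
  have h3 : (0 : ℝ) < (2 ^ n) ^ t * 2 ^ n := by positivity
  have h4 := mul_lt_mul_of_pos_left ht h3
  linarith

lemma bad_card (k : ℕ) (ε : ℝ) (hε : 0 < ε) (hε1 : ε < 1) : ∃ t : ℕ, ∀ n : ℕ,
    ((RMf (k + 1) n).filter fun h => ε * 2 ^ n < ∑ x, sg (h x)).card ≤
      (2 ^ ((n + 1) ^ k)) ^ t := by
  classical
  obtain ⟨t, ht⟩ := exists_pow_lt_of_lt_one (y := 1 - ε ^ 2 / 2)
    (show (0 : ℝ) < 1 / 2 ^ (k + 2) by positivity) (by nlinarith [sq_nonneg ε, pow_pos hε 2])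
  refine ⟨t, fun n => ?_⟩
  set bad := (RMf (k + 1) n).filter fun h => ε * 2 ^ n < ∑ x, sg (h x) with hbad
  have hex : ∀ h : BF n, ∃ a : Fin t → Fin n → ZMod 2, h ∈ bad →
      ((Fail h a).card : ℝ) < 1 / 2 ^ (k + 2) * 2 ^ n := by
    intro h
    by_cases hh : h ∈ bad
    · obtain ⟨a, ha⟩ := exists_shift h ε hε hε1 t _ ht (Finset.mem_filter.mp hh).2
      exact ⟨a, fun _ => ha⟩
    · exact ⟨0, fun h' => absurd h' hh⟩
  choose a ha using hex
  let q : BF n → Fin t → BF n := fun h j x => h (x + a h j) + h x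
  have hmaps : ∀ h ∈ bad, q h ∈ Fintype.piFinset (fun _ : Fin t => RMf k n) := by
    intro h hh
    rw [Fintype.mem_piFinset]
    intro j
    rw [mem_RMf]
    exact RM_deriv _ (mem_RMf.mp (Finset.mem_filter.mp hh).1)
  -- off the failure set, the majority of the derivatives recovers the function
  have hrec : ∀ h : BF n, ∀ x, x ∉ Fail h (a h) →
      h x = if 0 < ∑ j, sg (q h j x) then 0 else 1 := by
    intro h x hx
    have hx' : 0 < ∑ j, sg (h (x + a h j)) := by simpa [Fail] using hx
    have e : ∑ j, sg (q h j x) = (∑ j, sg (h (x + a h j))) * sg (h x) := by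
      simp only [q, sg_add, Finset.sum_mul]
    rw [e]
    rcases zmod2_cases (h x) with h0 | h0
    · rw [h0, sg_zero, mul_one, if_pos hx']
    · rw [h0, sg_one, if_neg (by linarith)]
  have hinj : Set.InjOn q bad := by
    intro h hh h' hh' hq
    by_contra hne
    have hsum : h + h' ∈ RM (k + 1) n :=
      RM_add (mem_RMf.mp (Finset.mem_filter.mp hh).1) (mem_RMf.mp (Finset.mem_filter.mp hh').1)
    have hn0 : h + h' ≠ 0 := by
      intro h0
      apply hne
      funext x
      exact CharTwo.add_eq_zero.mp (congrFun h0 x)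
    have hd := RM_min_dist (k + 1) _ hsum hn0
    have hsub : (Finset.univ.filter fun x => (h + h') x ≠ 0) ⊆
        Fail h (a h) ∪ Fail h' (a h') := by
      intro x hx
      by_contra hcon
      rw [Finset.mem_union, not_or] at hcon
      have h1 := hrec h x hcon.1
      have h2 := hrec h' x hcon.2
      rw [hq, ← h2] at h1
      simp only [Finset.mem_filter, Finset.mem_univ, true_and, Pi.add_apply] at hx
      exact hx (CharTwo.add_eq_zero.mpr h1)
    have hc := (Finset.card_le_card hsub).trans (Finset.card_union_le _ _)
    have hc' : ((Finset.univ.filter fun x => (h + h') x ≠ 0).card : ℝ) ≤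
        (Fail h (a h)).card + (Fail h' (a h')).card := by exact_mod_cast hc
    have hd' : (2 : ℝ) ^ n ≤ 2 ^ (k + 1) *
      ((Finset.univ.filter fun x => (h + h') x ≠ 0).card : ℝ) := by exact_mod_cast hd
    have f1 := ha h hh
    have f2 := ha h' hh'
    have : (2 : ℝ) ^ (k + 1) * ((Finset.univ.filter fun x => (h + h') x ≠ 0).card : ℝ) <
        2 ^ (k + 1) * (1 / 2 ^ (k + 2) * 2 ^ n + 1 / 2 ^ (k + 2) * 2 ^ n) := by
      apply mul_lt_mul_of_pos_left _ (by positivity)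
      linarith
    have e : (2 : ℝ) ^ (k + 1) * (1 / 2 ^ (k + 2) * 2 ^ n + 1 / 2 ^ (k + 2) * 2 ^ n) = 2 ^ n := by
      rw [pow_succ (2 : ℝ) (k + 1)]; field_simp; ring
    linarith
  calc bad.card ≤ (Fintype.piFinset (fun _ : Fin t => RMf k n)).card :=
        Finset.card_le_card_of_injOn q hmaps hinj
    _ = (RMf k n).card ^ t := by simp
    _ ≤ _ := Nat.pow_le_pow_left (RMf_card_le k n) t

lemma SS_eq (g f : BF n) : SS g f = 2 ^ n - 2 * hdist f g := by
  classical
  unfold SS hdist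
  have h1 : ∀ x, sg (f x) * sg (g x) = 1 - 2 * (if f x ≠ g x then 1 else 0) := by
    intro x
    rcases zmod2_cases (f x) with h | h <;> rcases zmod2_cases (g x) with h' | h' <;>
      rw [h, h'] <;> norm_num [sg_zero, sg_one]
  simp only [h1]
  rw [Finset.sum_sub_distrib, ← Finset.mul_sum, Finset.sum_boole]
  have : Nat.card {x : Fin n → ZMod 2 | f x ≠ g x} =
      (Finset.univ.filter fun x => f x ≠ g x).card := by
    rw [Nat.card_eq_fintype_card, Fintype.card_subtype]; rfl
  rw [this]
  simp [ZMod.card]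

end reedmuller

lemma choose_lower (k n : ℕ) (hn : 2 * k + 1 ≤ n) :
    ((n : ℝ) + 1) ^ (k + 1) ≤ 2 ^ (k + 1) * (k + 1).factorial * n.choose (k + 1) := by
  have h := Nat.pow_le_choose (α := ℝ) (k + 1) n
  have hf : (0 : ℝ) < (k + 1).factorial := by positivity
  have h1 : ((n : ℝ) + 1) / 2 ≤ ((n + 1 - (k + 1) : ℕ) : ℝ) := by
    rw [Nat.cast_sub (by omega)]
    have : (2 * k + 1 : ℝ) ≤ n := by exact_mod_cast hn
    push_cast; linarith
  have h2 : (((n : ℝ) + 1) / 2) ^ (k + 1) ≤ ((n + 1 - (k + 1) : ℕ) : ℝ) ^ (k + 1) := by gcongr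
  have h3 : ((n + 1 - (k + 1) : ℕ) : ℝ) ^ (k + 1) ≤ (k + 1).factorial * n.choose (k + 1) := by
    rw [div_le_iff₀ hf] at h
    push_cast at h ⊢
    linarith
  rw [div_pow] at h2
  have h4 := h2.trans h3
  rw [div_le_iff₀ (by positivity)] at h4
  linarith

lemma asymp (k t : ℕ) (η : ℝ) (hη : 0 < η) : ∀ᶠ n : ℕ in atTop,
    2 * (t * ((n : ℝ) + 1) ^ k * log 2) ≤ η ^ 3 / 3 * (n.choose (k + 1) * log 2) ∧
    ((n : ℝ) + 1) ^ (k + 1) * log 2 ≤ η ^ 4 / 16 * 2 ^ n ∧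
    log 16 ≤ η ^ 4 / 16 * (n.choose (k + 1) * log 2) ∧ 0 < (n.choose (k + 1) : ℝ) := by
  have l2 : 0 < log 2 := Real.log_pos (by norm_num)
  set c : ℝ := 2 ^ (k + 1) * (k + 1).factorial with hc
  have hc0 : 0 < c := by positivity
  have hbig : Tendsto (fun n : ℕ => (n : ℝ)) atTop atTop := tendsto_natCast_atTop_atTop
  have hexp : ∀ᶠ n : ℕ in atTop, ((n + 1 : ℕ) : ℝ) ^ (k + 1) / 2 ^ (n + 1) <
      η ^ 4 / 32 / log 2 :=
    ((tendsto_add_atTop_iff_nat 1).mpr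
      (tendsto_pow_const_div_const_pow_of_one_lt (k + 1) (show (1 : ℝ) < 2 by norm_num))).eventually_lt_const
      (by positivity)
  filter_upwards [eventually_ge_atTop (2 * k + 1), hexp,
    hbig.eventually_ge_atTop (2 * t * 3 / η ^ 3 * c),
    hbig.eventually_ge_atTop (log 16 * 16 / η ^ 4 / log 2 * c)] with n hn h1 h2 h3
  have hl := choose_lower k n hn
  rw [← hc] at hl
  have hp : (0 : ℝ) < ((n : ℝ) + 1) ^ k := by positivity
  have hp1 : (1 : ℝ) ≤ ((n : ℝ) + 1) ^ k := one_le_pow₀ (by linarith [Nat.cast_nonneg (α := ℝ) n])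
  rw [pow_succ] at hl
  refine ⟨?_, ?_, ?_, ?_⟩
  · have a1 : ((n : ℝ) + 1) ^ k * (2 * t * 3 / η ^ 3 * c) ≤ c * n.choose (k + 1) := by
      refine le_trans ?_ hl
      gcongr; linarith
    have a2 : ((n : ℝ) + 1) ^ k * (2 * t * 3 / η ^ 3) ≤ n.choose (k + 1) := by
      apply le_of_mul_le_mul_left _ hc0; linarith
    have a3 : η ^ 3 / 3 * (((n : ℝ) + 1) ^ k * (2 * t * 3 / η ^ 3)) ≤
        η ^ 3 / 3 * n.choose (k + 1) := by gcongr
    have a4 : η ^ 3 / 3 * (((n : ℝ) + 1) ^ k * (2 * t * 3 / η ^ 3)) =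
        2 * (t * ((n : ℝ) + 1) ^ k) := by field_simp
    rw [a4] at a3
    have := mul_le_mul_of_nonneg_right a3 l2.le
    linarith
  · rw [div_lt_div_iff₀ (by positivity) l2] at h1
    push_cast at h1
    rw [pow_succ (2 : ℝ) n] at h1
    linarith
  · have a1 : (log 16 * 16 / η ^ 4 / log 2 * c) ≤ c * n.choose (k + 1) := by
      refine le_trans ?_ hl
      nlinarith [Nat.cast_nonneg (α := ℝ) n]
    have a2 : log 16 * 16 / η ^ 4 / log 2 ≤ n.choose (k + 1) := by
      apply le_of_mul_le_mul_left _ hc0; linarith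
    calc log 16 = η ^ 4 / 16 * (log 16 * 16 / η ^ 4 / log 2 * log 2) := by field_simp
      _ ≤ _ := by gcongr
  · exact_mod_cast Nat.choose_pos (by omega)

theorem stmt12 (r : ℕ) (hr : 1 ≤ r) (δ : ℝ) (hδ0 : 0 < δ) (hδ1 : δ < 1) :
    ∀ᶠ n : ℕ in atTop,
      (1 - δ) * Real.sqrt (2^(n+1) * (n.choose r) * Real.log 2)
        ≤ (∑ g : BF n, ((2^n : ℝ) - 2 * nonlin r g)) / 2^(2^n) := by
  obtain ⟨k, rfl⟩ : ∃ k, r = k + 1 := ⟨r - 1, by omega⟩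
  set η := δ / 5 with hη
  have hη0 : 0 < η := by positivity
  have hη1 : η < 1 / 4 := by linarith
  have l2 : 0 < Real.log 2 := Real.log_pos (by norm_num)
  have hη4 : η ^ 4 < 1 := pow_lt_one₀ hη0.le (by linarith) (by norm_num)
  obtain ⟨t, ht⟩ := bad_card k (η ^ 4 / 8) (by positivity) (by linarith)
  filter_upwards [asymp k t η hη0] with n hn
  obtain ⟨h1, h2, h3, h4⟩ := hn
  have hcard : (Fintype.card (Fin n → ZMod 2) : ℝ) = 2 ^ n := by simp [ZMod.card]
  have hcardN : Fintype.card (Fin n → ZMod 2) = 2 ^ n := by simp [ZMod.card]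
  set Λ := Real.log (RMf (k + 1) n).card with hΛ
  have hlow : (n.choose (k + 1) : ℝ) * Real.log 2 ≤ Λ := by
    rw [hΛ, ← Real.log_pow]
    apply Real.log_le_log (by positivity)
    exact_mod_cast RMf_card_ge (k + 1) n
  have hpos : 0 < (RMf (k + 1) n).card := lt_of_lt_of_le (by positivity) (RMf_card_ge (k + 1) n)
  have hupp : Λ ≤ ((n : ℝ) + 1) ^ (k + 1) * Real.log 2 := by
    have : ((n : ℝ) + 1) ^ (k + 1) = (((n + 1) ^ (k + 1) : ℕ) : ℝ) := by push_cast; ring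
    rw [hΛ, this, ← Real.log_pow]
    apply Real.log_le_log (by exact_mod_cast hpos)
    exact_mod_cast RMf_card_le (k + 1) n
  have hmain := core (V := Fin n → ZMod 2) (RMf (k + 1) n) (Finset.card_pos.mp hpos)
    (fun f => (2 ^ n : ℝ) - 2 * nonlin (k + 1) f)
    (by
      intro f g hg
      rw [SS_eq]
      have : nonlin (k + 1) f ≤ hdist f g := Nat.sInf_le ⟨g, mem_RMf.mp hg, rfl⟩
      have : (nonlin (k + 1) f : ℝ) ≤ hdist f g := by exact_mod_cast this
      linarith)
    (t * ((n : ℝ) + 1) ^ k * Real.log 2) η Λ (by rw [hcard]; positivity) hη0 hη1 hΛ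
    (lt_of_lt_of_le (by positivity) hlow)
    (by
      intro g hg
      have hexp : Real.exp (t * ((n : ℝ) + 1) ^ k * Real.log 2) =
          (((2 ^ ((n + 1) ^ k)) ^ t : ℕ) : ℝ) := by
        have : (t : ℝ) * ((n : ℝ) + 1) ^ k = ((((n + 1) ^ k) * t : ℕ) : ℝ) := by
          push_cast; ring
        rw [this, Real.exp_nat_mul, Real.exp_log (by norm_num), pow_mul]
        push_cast; rfl
      rw [hexp, hcard]
      refine Nat.cast_le.mpr (le_trans ?_ (ht n))
      refine Finset.card_le_card_of_injOn (fun h => g + h) ?_ ?_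
      · intro h hh
        have hh' := Finset.mem_filter.mp hh
        refine Finset.mem_coe.mpr (Finset.mem_filter.mpr ⟨?_, ?_⟩)
        · exact mem_RMf.mpr (RM_add (mem_RMf.mp hg) (mem_RMf.mp hh'.1))
        · refine lt_of_lt_of_eq hh'.2 ?_
          unfold SS
          refine Finset.sum_congr rfl fun x _ => ?_
          rw [mul_comm]; exact (sg_add (g x) (h x)).symm
      · intro h _ h' _ e
        exact add_left_cancel e)
    (by positivity)
    (h1.trans (by gcongr))
    (by rw [hcard]; exact hupp.trans h2)
    (h3.trans (by gcongr))
  unfold Em at hmain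
  rw [hcard, hcardN] at hmain
  refine le_trans ?_ hmain
  have hle : Real.sqrt (2^(n+1) * (n.choose (k + 1)) * Real.log 2) ≤
      Real.sqrt (2 * 2 ^ n * Λ) := by
    apply Real.sqrt_le_sqrt
    rw [pow_succ']
    have := mul_le_mul_of_nonneg_left hlow (show (0 : ℝ) ≤ 2 * 2 ^ n by positivity)
    linarith
  calc _ ≤ (1 - δ) * Real.sqrt (2 * 2 ^ n * Λ) :=
        mul_le_mul_of_nonneg_left hle (by linarith)
    _ ≤ _ := by
      apply mul_le_mul_of_nonneg_right _ (Real.sqrt_nonneg _)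
      rw [hη]; linarith
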